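/- Let m ≥ 2 and let P^M be the MERW transition matrix on the rose graph R_m^4 with N_m = 3m + 1 vertices: from the hub, probability 1/(2m) to each internal node; from each internal node, probability m/(m+1) to the hub and 1/(m+1) to its peripheral neighbor; from each peripheral node, probability 1/2 to each of its two internal neighbors. Suppose T : V × V → ℝ satisfies T(j,j) = 0 for every vertex j and T(i,j) = 1 + Σ_k P^M(i,k)·T(k,j) for all vertices i ≠ j. Then the global mean hitting time equals ⟨T⟩^M = (1/(N_m(N_m − 1)))·Σ_i Σ_j T(i,j) = (6m³ + 36m² + 10m − 12)/(9m + 3). -/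

import Mathlib

open Finset
/-- Transition matrix of the maximal entropy random walk (MERW) on the rose graph
`R_m^4`: from the hub (vertex `0`) probability `1/(2m)` to each internal node; from each
internal node probability `m/(m+1)` to the hub and `1/(m+1)` to its peripheral neighbor;
from each peripheral node probability `1/2` to each of its two internal neighbors. -/
noncomputable def rosePM (m : ℕ) : Matrix (Fin (3 * m + 1)) (Fin (3 * m + 1)) ℝ :=
  fun i j =>
    if (i : ℕ) = 0 ∧ (j : ℕ) % 3 ≠ 0 then 1 / (2 * (m : ℝ))
    else if (i : ℕ) % 3 ≠ 0 ∧ (j : ℕ) = 0 then (m : ℝ) / ((m : ℝ) + 1)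
    else if ((i : ℕ) % 3 = 1 ∧ (j : ℕ) = (i : ℕ) + 2)
        ∨ ((i : ℕ) % 3 = 2 ∧ (j : ℕ) = (i : ℕ) + 1) then 1 / ((m : ℝ) + 1)
    else if (i : ℕ) % 3 = 0 ∧ (i : ℕ) ≠ 0
        ∧ ((j : ℕ) + 2 = (i : ℕ) ∨ (j : ℕ) + 1 = (i : ℕ)) then 1 / 2
    else 0

theorem sum_fin_three_mul_add_one {M : Type*} [AddCommMonoid M] (m : ℕ) (F : ℕ → M) :
    ∑ i : Fin (3 * m + 1), F i
      = F 0 + ∑ p ∈ range m, (F (3 * p + 1) + F (3 * p + 2) + F (3 * p + 3)) := by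
  rw [Fin.sum_univ_eq_sum_range]
  induction m with
  | zero => simp
  | succ m ih =>
    rw [show 3 * (m + 1) + 1 = 3 * m + 1 + 1 + 1 + 1 by ring, sum_range_succ, sum_range_succ,
      sum_range_succ, ih, sum_range_succ]
    simp only [add_assoc]

theorem rosePM_row_hub (m : ℕ) (f : ℕ → ℝ) :
    ∑ k, rosePM m 0 k * f k
      = 1 / (2 * (m : ℝ)) * ∑ p ∈ range m, (f (3 * p + 1) + f (3 * p + 2)) := by
  let F : ℕ → ℝ := fun n => (if n % 3 ≠ 0 then 1 / (2 * (m : ℝ)) else 0) * f n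
  have h : ∑ k, rosePM m 0 k * f k = ∑ k : Fin (3 * m + 1), F k := by
    simp [rosePM, F]
  rw [h, sum_fin_three_mul_add_one m F]
  simp [F, Nat.add_mod, mul_add, mul_sum]

theorem sum_fin_eq_of_two_support {n : ℕ} (w : Fin n → ℝ) (f : ℕ → ℝ) {u v : ℕ}
    (hu : u < n) (hv : v < n) (huv : u ≠ v) {α β : ℝ} (hα : w ⟨u, hu⟩ = α) (hβ : w ⟨v, hv⟩ = β)
    (h : ∀ k : Fin n, (k : ℕ) ≠ u → (k : ℕ) ≠ v → w k = 0) :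
    ∑ k, w k * f k = α * f u + β * f v := by
  rw [Fintype.sum_eq_add (⟨u, hu⟩ : Fin n) ⟨v, hv⟩ (by simpa using huv), hα, hβ]
  rintro k ⟨hku, hkv⟩
  rw [h k (fun e => hku (Fin.ext e)) (fun e => hkv (Fin.ext e)), zero_mul]

theorem rosePM_row_internal (m : ℕ) (f : ℕ → ℝ) {p r : ℕ} (hp : p < m) (hr : r = 1 ∨ r = 2)
    (hi : 3 * p + r < 3 * m + 1) :
    ∑ k, rosePM m ⟨3 * p + r, hi⟩ k * f k
      = (m : ℝ) / ((m : ℝ) + 1) * f 0 + 1 / ((m : ℝ) + 1) * f (3 * p + 3) := by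
  refine sum_fin_eq_of_two_support _ f (by omega) (by omega) (by omega) ?_ ?_ ?_
  · unfold rosePM
    rw [if_neg (by simp), if_pos (by dsimp only; omega)]
  · unfold rosePM
    rw [if_neg (by dsimp only; omega), if_neg (by dsimp only; omega),
      if_pos (by dsimp only; omega)]
  · intro k h0 h3
    unfold rosePM
    rw [if_neg (by dsimp only; omega), if_neg (by dsimp only; omega),
      if_neg (by dsimp only; omega), if_neg (by dsimp only; omega)]

theorem rosePM_row_peripheral (m : ℕ) (f : ℕ → ℝ) {p : ℕ} (hp : p < m)
    (hi : 3 * p + 3 < 3 * m + 1) :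
    ∑ k, rosePM m ⟨3 * p + 3, hi⟩ k * f k
      = 1 / 2 * f (3 * p + 1) + 1 / 2 * f (3 * p + 2) := by
  refine sum_fin_eq_of_two_support _ f (by omega) (by omega) (by omega) ?_ ?_ ?_
  · unfold rosePM
    rw [if_neg (by dsimp only; omega), if_neg (by dsimp only; omega),
      if_neg (by dsimp only; omega), if_pos (by dsimp only; omega)]
  · unfold rosePM
    rw [if_neg (by dsimp only; omega), if_neg (by dsimp only; omega),
      if_neg (by dsimp only; omega), if_pos (by dsimp only; omega)]
  · intro k h1 h2
    unfold rosePM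
    rw [if_neg (by dsimp only; omega), if_neg (by dsimp only; omega),
      if_neg (by dsimp only; omega), if_neg (by dsimp only; omega)]

/-- `f` satisfies the first-step equations for hitting times of `j` on the rose graph. -/
structure IsRoseHitting (m j : ℕ) (f : ℕ → ℝ) : Prop where
  target : f j = 0
  hub : j ≠ 0 → 2 * (m : ℝ) * (f 0 - 1) = ∑ p ∈ range m, (f (3 * p + 1) + f (3 * p + 2))
  internal : ∀ p < m, ∀ r, r = 1 ∨ r = 2 → 3 * p + r ≠ j →
    ((m : ℝ) + 1) * f (3 * p + r) = (m : ℝ) + 1 + m * f 0 + f (3 * p + 3)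
  peripheral : ∀ p < m, 3 * p + 3 ≠ j →
    2 * f (3 * p + 3) = 2 + f (3 * p + 1) + f (3 * p + 2)

theorem isRoseHitting_of_step {m : ℕ} (hm : m ≠ 0) (f : ℕ → ℝ) (j : Fin (3 * m + 1))
    (hj : f j = 0)
    (hstep : ∀ i : Fin (3 * m + 1), i ≠ j → f i = 1 + ∑ k, rosePM m i k * f k) :
    IsRoseHitting m j f := by
  have hm0 : (m : ℝ) ≠ 0 := Nat.cast_ne_zero.mpr hm
  have hm1 : (m : ℝ) + 1 ≠ 0 := by positivity
  refine ⟨hj, fun h => ?_, fun p hp r hr h => ?_, fun p hp h => ?_⟩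
  · have e := hstep 0 (fun e => h (by simp [← e]))
    rw [rosePM_row_hub] at e
    rw [Fin.val_zero] at e
    rw [e]
    field_simp
    ring
  · have hi : 3 * p + r < 3 * m + 1 := by omega
    have e := hstep ⟨3 * p + r, hi⟩ (fun e => h (by simp [← e]))
    rw [rosePM_row_internal m f hp hr] at e
    dsimp only at e
    rw [e]
    field_simp
    ring
  · have hi : 3 * p + 3 < 3 * m + 1 := by omega
    have e := hstep ⟨3 * p + 3, hi⟩ (fun e => h (by simp [← e]))
    rw [rosePM_row_peripheral m f hp] at e
    dsimp only at e
    linarith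

namespace IsRoseHitting

variable {m j : ℕ} {f : ℕ → ℝ}

theorem block_eq (h : IsRoseHitting m j f) {p : ℕ} (hp : p < m) (h1 : 3 * p + 1 ≠ j)
    (h2 : 3 * p + 2 ≠ j) (h3 : 3 * p + 3 ≠ j) :
    f (3 * p + 1) = f 0 + 1 + 2 / m ∧ f (3 * p + 2) = f 0 + 1 + 2 / m ∧
      f (3 * p + 3) = f 0 + 2 + 2 / m := by
  have hm0 : (m : ℝ) ≠ 0 := Nat.cast_ne_zero.mpr (by omega)
  have hm1 : (m : ℝ) + 1 ≠ 0 := by positivity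
  have e1 := h.internal p hp 1 (.inl rfl) h1
  have e2 := h.internal p hp 2 (.inr rfl) h2
  have e3 := h.peripheral p hp h3
  have e12 : f (3 * p + 1) = f (3 * p + 2) := mul_left_cancel₀ hm1 (e1.trans e2.symm)
  have ha : f (3 * p + 1) = f 0 + 1 + 2 / m := by
    field_simp
    linarith
  exact ⟨ha, e12 ▸ ha, by linarith⟩

theorem sum_of_target_hub (hm : m ≠ 0) (h : IsRoseHitting m 0 f) :
    ∑ i : Fin (3 * m + 1), f i = 4 * m + 6 := by
  have hm0 : (m : ℝ) ≠ 0 := Nat.cast_ne_zero.mpr hm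
  have hb : ∀ p ∈ range m, f (3 * p + 1) + f (3 * p + 2) + f (3 * p + 3) = 4 + 6 / m := by
    intro p hp
    obtain ⟨h1, h2, h3⟩ := h.block_eq (mem_range.mp hp) (by omega) (by omega) (by omega)
    rw [h1, h2, h3, h.target]
    ring
  rw [sum_fin_three_mul_add_one, sum_congr rfl hb, h.target, sum_const, card_range, nsmul_eq_mul]
  field_simp
  ring

/-- The contribution of the cycles not containing the target `j = 3 * q + r`. -/
theorem hub_and_sum_of_target_block (h : IsRoseHitting m j f) {q r : ℕ} (hq : q < m)
    (hr : r = 1 ∨ r = 2 ∨ r = 3) (hj : j = 3 * q + r) :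
    2 * (m : ℝ) * (f 0 - 1)
        = f (3 * q + 1) + f (3 * q + 2) + (m - 1) * (2 * f 0 + 2 + 4 / m) ∧
      ∑ i : Fin (3 * m + 1), f i = f 0 + (f (3 * q + 1) + f (3 * q + 2) + f (3 * q + 3)
        + (m - 1) * (3 * f 0 + 4 + 6 / m)) := by
  have hb : ∀ p ∈ (range m).erase q, f (3 * p + 1) = f 0 + 1 + 2 / m ∧
      f (3 * p + 2) = f 0 + 1 + 2 / m ∧ f (3 * p + 3) = f 0 + 2 + 2 / m := by
    intro p hp
    obtain ⟨hpq, hp⟩ := mem_erase.mp hp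
    exact h.block_eq (mem_range.mp hp) (by omega) (by omega) (by omega)
  have hc : (((range m).erase q).card : ℝ) = m - 1 := by
    rw [card_erase_of_mem (mem_range.mpr hq), card_range, Nat.cast_sub (by omega), Nat.cast_one]
  constructor
  · rw [h.hub (by omega), ← add_sum_erase _ _ (mem_range.mpr hq), ← hc, ← nsmul_eq_mul]
    congr 1
    refine sum_eq_card_nsmul fun p hp => ?_
    obtain ⟨h1, h2, -⟩ := hb p hp
    rw [h1, h2]
    ring
  · rw [sum_fin_three_mul_add_one, ← add_sum_erase _ _ (mem_range.mpr hq), ← hc, ← nsmul_eq_mul]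
    congr 2
    refine sum_eq_card_nsmul fun p hp => ?_
    obtain ⟨h1, h2, h3⟩ := hb p hp
    rw [h1, h2, h3]
    ring

theorem sum_of_target_peripheral {q : ℕ} (hq : q < m) (h : IsRoseHitting m (3 * q + 3) f) :
    ∑ i : Fin (3 * m + 1), f i = (3 * m - 2) * (2 * (m + 1) * (m ^ 2 + m - 1) / m)
      + (m - 1) * (4 + 6 / m) + 2 + 4 * (m ^ 2 + m - 1) := by
  have hm0 : (m : ℝ) ≠ 0 := Nat.cast_ne_zero.mpr (by omega)
  have hm1 : (m : ℝ) + 1 ≠ 0 := by positivity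
  obtain ⟨e0, hs⟩ := h.hub_and_sum_of_target_block hq (.inr (.inr rfl)) rfl
  have e1 := h.internal q hq 1 (.inl rfl) (by omega)
  have e2 := h.internal q hq 2 (.inr rfl) (by omega)
  rw [h.target] at e1 e2 hs
  have hx : f 0 = 2 * (m + 1) * (m ^ 2 + m - 1) / m := by
    field_simp at e0 ⊢
    linear_combination ((m : ℝ) + 1) / 2 * e0 + (m : ℝ) / 2 * (e1 + e2)
  have hab : f (3 * q + 1) + f (3 * q + 2) = 2 + 4 * (m ^ 2 + m - 1) := by
    apply mul_left_cancel₀ hm1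
    rw [mul_add, e1, e2, hx]
    field_simp
    ring
  rw [hs, hab, hx]
  ring

theorem sum_of_target_internal {q r s : ℕ} (hq : q < m) (hrs : r = 1 ∧ s = 2 ∨ r = 2 ∧ s = 1)
    (h : IsRoseHitting m (3 * q + r) f) :
    ∑ i : Fin (3 * m + 1), f i = (3 * m - 2) * (4 * m + 1 - 2 / m)
      + (m - 1) * (4 + 6 / m) + 6 * m + 1 := by
  have hm0 : (m : ℝ) ≠ 0 := Nat.cast_ne_zero.mpr (by omega)
  have hm1 : (m : ℝ) + 1 ≠ 0 := by positivity
  obtain ⟨e0, hs⟩ := h.hub_and_sum_of_target_block hq (by omega) rfl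
  have e1 := h.internal q hq s (by omega) (by omega)
  have e2 := h.peripheral q hq (by omega)
  have hsum : f (3 * q + 1) + f (3 * q + 2) = f (3 * q + s) := by
    have ht := h.target
    obtain ⟨rfl, rfl⟩ | ⟨rfl, rfl⟩ := hrs <;> simp [ht]
  rw [add_assoc, hsum] at e2
  rw [hsum] at e0 hs
  have hb : f (3 * q + s) = 2 * f 0 - (4 * m + 2 - 4 / m) := by
    field_simp at e0 ⊢
    linear_combination -e0
  have hc : f (3 * q + 3) = 1 + f (3 * q + s) / 2 := by linarith
  have hx : f 0 = 4 * m + 1 - 2 / m := by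
    rw [hc, hb] at e1
    field_simp at e1 ⊢
    apply mul_left_cancel₀ hm1
    linear_combination e1 / 2
  rw [hs, hc, hb, hx]
  ring

end IsRoseHitting

/-- Global mean hitting time of the MERW on the rose graph `R_m^4` with `N_m = 3m+1`
vertices: `⟨T⟩ = (6m³+36m²+10m-12)/(9m+3)`. -/
theorem rose_merw_global_mean_hitting (m : ℕ) (hm : 2 ≤ m)
    (T : Fin (3 * m + 1) → Fin (3 * m + 1) → ℝ)
    (hdiag : ∀ j, T j j = 0)
    (hstep : ∀ i j : Fin (3 * m + 1), i ≠ j →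
      T i j = 1 + ∑ k, rosePM m i k * T k j) :
    (1 / ((3 * (m : ℝ) + 1) * (3 * (m : ℝ)))) * ∑ i, ∑ j, T i j
      = (6 * (m : ℝ) ^ 3 + 36 * (m : ℝ) ^ 2 + 10 * (m : ℝ) - 12)
          / (9 * (m : ℝ) + 3) := by
  have hm0 : (m : ℝ) ≠ 0 := Nat.cast_ne_zero.mpr (by omega)
  have hm3 : 3 * (m : ℝ) + 1 ≠ 0 := by positivity
  have hcol : ∀ j : Fin (3 * m + 1), IsRoseHitting m j fun n => T (Fin.ofNat _ n) j := by
    intro j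
    refine isRoseHitting_of_step (by omega) _ j ?_ fun i hi => ?_
    · simpa using hdiag j
    · simpa using hstep i j hi
  have hcol' : ∀ n < 3 * m + 1,
      IsRoseHitting m n fun k => T (Fin.ofNat _ k) (Fin.ofNat _ n) := by
    intro n hn
    simpa [Nat.mod_eq_of_lt hn] using hcol (Fin.ofNat _ n)
  let C : ℕ → ℝ := fun n => ∑ i : Fin (3 * m + 1), T (Fin.ofNat _ i) (Fin.ofNat _ n)
  have hS : ∑ i, ∑ j, T i j = ∑ j : Fin (3 * m + 1), C j := by
    rw [sum_comm]
    simp [C]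
  rw [hS, sum_fin_three_mul_add_one m C]
  dsimp only [C]
  rw [(hcol' 0 (by omega)).sum_of_target_hub (by omega),
    sum_congr rfl fun p hp => by
      have hp := mem_range.mp hp
      rw [(hcol' (3 * p + 1) (by omega)).sum_of_target_internal hp (.inl ⟨rfl, rfl⟩),
        (hcol' (3 * p + 2) (by omega)).sum_of_target_internal hp (.inr ⟨rfl, rfl⟩),
        (hcol' (3 * p + 3) (by omega)).sum_of_target_peripheral hp],
    sum_const, card_range, nsmul_eq_mul]
  field_simp
  ring
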